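/- Let I : (0,1) → (0,1) be quasiconcave and satisfy condition (★), and let ‖·‖_X be an r.i. norm with associate norm ‖·‖_{X'}. Then there exist constants c₁, c₂ > 0 such that for every f ∈ M_+(0,1): c₁·‖f‖_{Y_X} ≤ sup{ ∫_{(0,1)} I(t)·g^*(t) dν_f(t) : g ∈ M_+(0,1), ‖S_I g‖_{X'} ≤ 1 } + ‖f‖_1 ≤ c₂·‖f‖_{Y_X}, where ν_f is the Lebesgue–Stieltjes measure on (0,1) induced by the nonincreasing function f^* via ν_f((a,b]) = f^*(a+) − f^*(b+) (this integral is written ∫_0^1 −I(t) g^*(t) df^*(t)). -/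

import Mathlib

open MeasureTheory Set Filter
open scoped ENNReal

noncomputable section

/-- The nonincreasing rearrangement of `f` over `(0,1)`. -/
def rearr (f : ℝ → ℝ≥0∞) (t : ℝ) : ℝ≥0∞ :=
  sInf {l : ℝ≥0∞ | volume {s ∈ Set.Ioo (0:ℝ) 1 | l < f s} ≤ ENNReal.ofReal t}

/-- The maximal nonincreasing rearrangement `f^{**}(t) = (1/t) ∫_0^t f^*(s) ds`. -/
def dstar (f : ℝ → ℝ≥0∞) (t : ℝ) : ℝ≥0∞ :=
  (ENNReal.ofReal t)⁻¹ * ∫⁻ s in Set.Ioo (0:ℝ) t, rearr f s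

/-- The `L¹(0,1)` norm. -/
def lOne (f : ℝ → ℝ≥0∞) : ℝ≥0∞ := ∫⁻ t in Set.Ioo (0:ℝ) 1, f t

/-- The norm of the Marcinkiewicz-type space `m_I`. -/
def mNorm (I : ℝ → ℝ) (f : ℝ → ℝ≥0∞) : ℝ≥0∞ :=
  ⨆ t ∈ Set.Ioo (0:ℝ) 1, ENNReal.ofReal (I t) * rearr f t

/-- The norm of `m_Ĩ` where `Ĩ(t) = t / I(t)`. -/
def mNormTilde (I : ℝ → ℝ) (f : ℝ → ℝ≥0∞) : ℝ≥0∞ :=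
  ⨆ t ∈ Set.Ioo (0:ℝ) 1, ENNReal.ofReal (t / I t) * rearr f t

/-- The supremum operator `S_I f(t) = (1/I(t)) sup_{0<s≤t} I(s) f^*(s)`. -/
def SI (I : ℝ → ℝ) (f : ℝ → ℝ≥0∞) : ℝ → ℝ≥0∞ := fun t =>
  (ENNReal.ofReal (I t))⁻¹ * ⨆ s ∈ Set.Ioc (0:ℝ) t, ENNReal.ofReal (I s) * rearr f s

/-- The supremum operator `T_I f(t) = (I(t)/t) sup_{t≤s<1} (s/I(s)) f^*(s)`. -/
def TI (I : ℝ → ℝ) (f : ℝ → ℝ≥0∞) : ℝ → ℝ≥0∞ := fun t =>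
  ENNReal.ofReal (I t / t) * ⨆ s ∈ Set.Ico t 1, ENNReal.ofReal (s / I s) * rearr f s

/-- `H_I f(t) = ∫_t^1 f(s)/I(s) ds`. -/
def HI (I : ℝ → ℝ) (f : ℝ → ℝ≥0∞) : ℝ → ℝ≥0∞ := fun t =>
  ∫⁻ s in Set.Ioo t 1, f s / ENNReal.ofReal (I s)

/-- `R_I f(t) = (1/I(t)) ∫_0^t f(s) ds`. -/
def RI (I : ℝ → ℝ) (f : ℝ → ℝ≥0∞) : ℝ → ℝ≥0∞ := fun t =>
  (ENNReal.ofReal (I t))⁻¹ * ∫⁻ s in Set.Ioo (0:ℝ) t, f s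

/-- `I : (0,1) → (0,1)` is quasiconcave: a nondecreasing bijection of `(0,1)` onto `(0,1)`
with `I(t)/t` nonincreasing, `I(0+) = 0` and `I(1-) = 1`. -/
def Quasiconcave (I : ℝ → ℝ) : Prop :=
  Set.BijOn I (Set.Ioo 0 1) (Set.Ioo 0 1) ∧
  MonotoneOn I (Set.Ioo 0 1) ∧
  AntitoneOn (fun t => I t / t) (Set.Ioo 0 1) ∧
  Tendsto I (nhdsWithin 0 (Set.Ioo 0 1)) (nhds 0) ∧
  Tendsto I (nhdsWithin 1 (Set.Ioo 0 1)) (nhds 1)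

/-- Condition (★): `∫_0^t I(s)/s ds ≲ I(t)`. -/
def StarCond (I : ℝ → ℝ) : Prop :=
  ∃ C : ℝ, 0 < C ∧ ∀ t ∈ Set.Ioo (0:ℝ) 1,
    ∫⁻ s in Set.Ioo (0:ℝ) t, ENNReal.ofReal (I s / s) ≤ ENNReal.ofReal (C * I t)

/-- The average property: `∫_0^t ds/I(s) ≲ t/I(t)`. -/
def AvgProp (I : ℝ → ℝ) : Prop :=
  ∃ C : ℝ, 0 < C ∧ ∀ t ∈ Set.Ioo (0:ℝ) 1,
    ∫⁻ s in Set.Ioo (0:ℝ) t, ENNReal.ofReal (1 / I s) ≤ ENNReal.ofReal (C * (t / I t))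

/-- The condition `∫_t^1 I(s)/s² ds ≲ (1/t) ∫_0^t I(s)/s ds`. -/
def MaxCond (I : ℝ → ℝ) : Prop :=
  ∃ C : ℝ, 0 < C ∧ ∀ t ∈ Set.Ioo (0:ℝ) 1,
    ∫⁻ s in Set.Ioo t 1, ENNReal.ofReal (I s / s ^ 2) ≤
      ENNReal.ofReal (C / t) * ∫⁻ s in Set.Ioo (0:ℝ) t, ENNReal.ofReal (I s / s)

/-- The class `𝒬` of quasiconcave functions. -/
def ClassQ (I : ℝ → ℝ) : Prop :=
  Quasiconcave I ∧ StarCond I ∧ AvgProp I ∧ MaxCond I ∧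
  ∃ c d : ℝ,
    IsLUB {l : ℝ | 0 ≤ l ∧ ∀ t ∈ Set.Ioo (0:ℝ) 1,
      ENNReal.ofReal (l * (I t / t ^ 2 - 1)) ≤
        ∫⁻ s in Set.Ioo t 1, ENNReal.ofReal (I s / s ^ 3)} c ∧
    IsLeast {e : ℝ | 0 < e ∧ ∀ t ∈ Set.Ioo (0:ℝ) 1,
      ∫⁻ s in Set.Ioo t 1, ENNReal.ofReal (I s / s ^ 2) ≤
        ENNReal.ofReal (e * (I t / t))} d ∧
    (1 - c) * d ≤ c

/-- The `Δ₂` condition: `I(2t) ≤ C I(t)` for `t ∈ (0,1/2)`. -/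
def Delta2 (I : ℝ → ℝ) : Prop :=
  ∃ C : ℝ, 0 < C ∧ ∀ t ∈ Set.Ioo (0:ℝ) (1/2), I (2 * t) ≤ C * I t

/-- A rearrangement-invariant Banach function norm on `M₊(0,1)`. -/
def IsRiNorm (ρ : (ℝ → ℝ≥0∞) → ℝ≥0∞) : Prop :=
  (∀ f : ℝ → ℝ≥0∞, Measurable f →
      (ρ f = 0 ↔ f =ᵐ[volume.restrict (Set.Ioo (0:ℝ) 1)] 0)) ∧
  (∀ f : ℝ → ℝ≥0∞, Measurable f → ∀ a : ℝ, 0 ≤ a →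
      ρ (fun t => ENNReal.ofReal a * f t) = ENNReal.ofReal a * ρ f) ∧
  (∀ f g : ℝ → ℝ≥0∞, Measurable f → Measurable g →
      ρ (fun t => f t + g t) ≤ ρ f + ρ g) ∧
  (∀ f g : ℝ → ℝ≥0∞, Measurable f → Measurable g →
      (∀ᵐ t ∂(volume.restrict (Set.Ioo (0:ℝ) 1)), f t ≤ g t) → ρ f ≤ ρ g) ∧
  (∀ (fn : ℕ → ℝ → ℝ≥0∞) (f : ℝ → ℝ≥0∞), (∀ n, Measurable (fn n)) → Measurable f →
      (∀ᵐ t ∂(volume.restrict (Set.Ioo (0:ℝ) 1)), Monotone (fun n => fn n t)) →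
      (∀ᵐ t ∂(volume.restrict (Set.Ioo (0:ℝ) 1)), (⨆ n, fn n t) = f t) →
      (⨆ n, ρ (fn n)) = ρ f) ∧
  (ρ (fun _ => 1) < ⊤) ∧
  (∃ c : ℝ, 0 < c ∧ ∀ f : ℝ → ℝ≥0∞, Measurable f →
      ∫⁻ t in Set.Ioo (0:ℝ) 1, f t ≤ ENNReal.ofReal c * ρ f) ∧
  (∀ f : ℝ → ℝ≥0∞, Measurable f → ρ f = ρ (rearr f))

/-- The associate norm `ρ'`. -/
def assoc (ρ : (ℝ → ℝ≥0∞) → ℝ≥0∞) (f : ℝ → ℝ≥0∞) : ℝ≥0∞ :=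
  ⨆ (g : ℝ → ℝ≥0∞) (_ : Measurable g ∧ ρ g ≤ 1),
    ∫⁻ t in Set.Ioo (0:ℝ) 1, f t * g t

/-- The optimal target norm `‖f‖_{Y_X}` of the r.i. norm `ρ = ‖·‖_X` under `H_I`. -/
def optTargetNorm (I : ℝ → ℝ) (ρ : (ℝ → ℝ≥0∞) → ℝ≥0∞) (f : ℝ → ℝ≥0∞) : ℝ≥0∞ :=
  ⨆ (g : ℝ → ℝ≥0∞) (_ : Measurable g ∧ assoc ρ (RI I (rearr g)) ≤ 1),
    ∫⁻ t in Set.Ioo (0:ℝ) 1, rearr f t * rearr g t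

/-- The optimal domain norm `‖f‖_{X_Y} = sup_{h ∼ f} ‖H_I h‖_Y`. -/
def optDomainNorm (I : ℝ → ℝ) (ρY : (ℝ → ℝ≥0∞) → ℝ≥0∞) (f : ℝ → ℝ≥0∞) : ℝ≥0∞ :=
  ⨆ (h : ℝ → ℝ≥0∞)
    (_ : Measurable h ∧ ∀ t ∈ Set.Ioo (0:ℝ) 1, rearr h t = rearr f t),
      ρY (HI I h)

/-- `H_I : X → Y` boundedly. -/
def HIBounded (I : ℝ → ℝ) (ρX ρY : (ℝ → ℝ≥0∞) → ℝ≥0∞) : Prop :=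
  ∃ C : ℝ, 0 < C ∧ ∀ f : ℝ → ℝ≥0∞, Measurable f →
    ρY (HI I f) ≤ ENNReal.ofReal C * ρX f

/-- `X` is the optimal domain space for `Y` under `H_I`. -/
def IsOptimalDomain (I : ℝ → ℝ) (ρX ρY : (ℝ → ℝ≥0∞) → ℝ≥0∞) : Prop :=
  HIBounded I ρX ρY ∧
  ∀ ρZ : (ℝ → ℝ≥0∞) → ℝ≥0∞, IsRiNorm ρZ → HIBounded I ρZ ρY →
    ∃ C : ℝ, 0 < C ∧ ∀ f : ℝ → ℝ≥0∞, Measurable f →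
      ρX f ≤ ENNReal.ofReal C * ρZ f

/-- `Y` is the optimal target space for `X` under `H_I`. -/
def IsOptimalTarget (I : ℝ → ℝ) (ρX ρY : (ℝ → ℝ≥0∞) → ℝ≥0∞) : Prop :=
  HIBounded I ρX ρY ∧
  ∀ ρZ : (ℝ → ℝ≥0∞) → ℝ≥0∞, IsRiNorm ρZ → HIBounded I ρX ρZ →
    ∃ C : ℝ, 0 < C ∧ ∀ f : ℝ → ℝ≥0∞, Measurable f →
      ρZ f ≤ ENNReal.ofReal C * ρY f

lemma rearr_anti (f : ℝ → ℝ≥0∞) : Antitone (rearr f) := by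
  intro s t hst
  apply sInf_le_sInf
  intro l hl
  exact le_trans hl (ENNReal.ofReal_le_ofReal hst)

lemma lt_rearr_iff (f : ℝ → ℝ≥0∞) (l : ℝ≥0∞) (t : ℝ) :
    l < rearr f t ↔ ENNReal.ofReal t < volume {s ∈ Set.Ioo (0:ℝ) 1 | l < f s} := by
  constructor
  · intro h
    by_contra hc
    exact absurd h (not_lt.mpr (sInf_le (not_lt.mp hc)))
  · intro h
    by_contra hc
    rw [not_lt] at hc
    apply absurd h
    rw [not_lt]
    rcases eq_or_ne l ⊤ with rfl | hl
    · simp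
    obtain ⟨u, hu, hu1, hu2⟩ := exists_seq_strictAnti_tendsto' (lt_top_iff_ne_top.mpr hl)
    have hU : {s ∈ Set.Ioo (0:ℝ) 1 | l < f s} = ⋃ n, {s ∈ Set.Ioo (0:ℝ) 1 | u n < f s} := by
      ext s
      simp only [mem_ofPred_eq, mem_iUnion, exists_and_left, and_congr_right_iff]
      intro _
      constructor
      · intro h
        exact (hu2.eventually_lt_const h).exists
      · rintro ⟨n, hn⟩
        exact (hu1 n).1.trans hn
    have hm : Monotone fun n => {s ∈ Set.Ioo (0:ℝ) 1 | u n < f s} := by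
      intro a b hab s hs
      exact ⟨hs.1, (hu.antitone hab).trans_lt hs.2⟩
    rw [hU, hm.measure_iUnion]
    apply iSup_le
    intro n
    obtain ⟨m, hm, hm2⟩ := sInf_lt_iff.mp (hc.trans_lt (hu1 n).1)
    refine le_trans (measure_mono ?_) hm
    intro s hs
    exact ⟨hs.1, hm2.trans hs.2⟩

lemma rearr_rightLim (f : ℝ → ℝ≥0∞) (a : ℝ) :
    Function.rightLim (rearr f) a = rearr f a := by
  have h : Tendsto (rearr f) (nhdsWithin a (Set.Ioi a)) (nhds (rearr f a)) := by
    rw [tendsto_order]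
    constructor
    · intro l hl
      rw [lt_rearr_iff] at hl
      have : ContinuousAt ENNReal.ofReal a := ENNReal.continuous_ofReal.continuousAt
      have h2 := (this.tendsto.eventually_lt_const hl)
      filter_upwards [nhdsWithin_le_nhds h2] with t ht
      rwa [lt_rearr_iff]
    · intro u hu
      filter_upwards [self_mem_nhdsWithin] with t ht
      exact (rearr_anti f (le_of_lt ht)).trans_lt hu
  exact rightLim_eq_of_tendsto h

lemma layer (μ : Measure ℝ) [SFinite μ] (f : ℝ → ℝ≥0∞) (hf : Measurable f) :
    ∫⁻ x, f x ∂μ = ∫⁻ l in Set.Ioi (0:ℝ), μ {x | ENNReal.ofReal l < f x} := by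
  have h1 : ∀ x, f x = ∫⁻ l in Set.Ioi (0:ℝ),
      Set.indicator {p : ℝ × ℝ | ENNReal.ofReal p.2 < f p.1} (fun _ => (1:ℝ≥0∞)) (x, l) := by
    intro x
    have hS : MeasurableSet {l : ℝ | ENNReal.ofReal l < f x} :=
      measurableSet_lt ENNReal.measurable_ofReal measurable_const
    have : (fun l : ℝ => Set.indicator {p : ℝ × ℝ | ENNReal.ofReal p.2 < f p.1}
        (fun _ => (1:ℝ≥0∞)) (x, l)) = Set.indicator {l : ℝ | ENNReal.ofReal l < f x} 1 := by
      ext l; simp [Set.indicator]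
    rw [this, lintegral_indicator_one hS, Measure.restrict_apply hS]
    rcases eq_or_ne (f x) ⊤ with h | h
    · simp [h]
    · have : {l : ℝ | ENNReal.ofReal l < f x} ∩ Set.Ioi 0 = Set.Ioo 0 (f x).toReal := by
        ext l
        simp only [mem_inter_iff, mem_ofPred_eq, mem_Ioi, mem_Ioo]
        constructor
        · rintro ⟨h1, h2⟩
          exact ⟨h2, (ENNReal.ofReal_lt_iff_lt_toReal h2.le h).mp h1⟩
        · rintro ⟨h1, h2⟩
          exact ⟨(ENNReal.ofReal_lt_iff_lt_toReal h1.le h).mpr h2, h1⟩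
      rw [this, Real.volume_Ioo, sub_zero, ENNReal.ofReal_toReal h]
  have hM : MeasurableSet {p : ℝ × ℝ | ENNReal.ofReal p.2 < f p.1} :=
    measurableSet_lt (ENNReal.measurable_ofReal.comp measurable_snd) (hf.comp measurable_fst)
  calc ∫⁻ x, f x ∂μ = ∫⁻ x, (∫⁻ l in Set.Ioi (0:ℝ),
      Set.indicator {p : ℝ × ℝ | ENNReal.ofReal p.2 < f p.1} (fun _ => (1:ℝ≥0∞)) (x, l)) ∂μ :=
        lintegral_congr h1
    _ = ∫⁻ l in Set.Ioi (0:ℝ), (∫⁻ x,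
      Set.indicator {p : ℝ × ℝ | ENNReal.ofReal p.2 < f p.1} (fun _ => (1:ℝ≥0∞)) (x, l) ∂μ) := by
        rw [lintegral_lintegral_swap]
        exact (measurable_const.indicator hM).aemeasurable
    _ = _ := by
        apply lintegral_congr
        intro l
        have hS : MeasurableSet {x : ℝ | ENNReal.ofReal l < f x} :=
          measurableSet_lt measurable_const hf
        rw [← lintegral_indicator_one hS]
        apply lintegral_congr
        intro x
        simp [Set.indicator]

lemma vol_aux (t : ℝ) (d : ℝ≥0∞) :
    volume {s ∈ Set.Ioo (0:ℝ) t | ENNReal.ofReal s < d} = min (ENNReal.ofReal t) d := by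
  rcases eq_or_ne d ⊤ with h | h
  · have : {s ∈ Set.Ioo (0:ℝ) t | ENNReal.ofReal s < d} = Set.Ioo 0 t := by
      ext s; simp [h]
    rw [this, h]; simp
  · have : {s ∈ Set.Ioo (0:ℝ) t | ENNReal.ofReal s < d} = Set.Ioo 0 (min t d.toReal) := by
      ext s
      simp only [mem_ofPred_eq, mem_Ioo, lt_min_iff]
      constructor
      · rintro ⟨⟨h1, h2⟩, h3⟩
        exact ⟨h1, h2, (ENNReal.ofReal_lt_iff_lt_toReal h1.le h).mp h3⟩
      · rintro ⟨h1, h2, h3⟩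
        exact ⟨⟨h1, h2⟩, (ENNReal.ofReal_lt_iff_lt_toReal h1.le h).mpr h3⟩
    rw [this, Real.volume_Ioo, sub_zero]
    conv_rhs => rw [← ENNReal.ofReal_toReal h]
    exact (ENNReal.ofReal_mono.map_min)

lemma layer_rearr (f : ℝ → ℝ≥0∞) (t : ℝ) :
    ∫⁻ s in Set.Ioo (0:ℝ) t, rearr f s = ∫⁻ l in Set.Ioi (0:ℝ),
      min (ENNReal.ofReal t) (volume {s ∈ Set.Ioo (0:ℝ) 1 | ENNReal.ofReal l < f s}) := by
  rw [layer _ _ (rearr_anti f).measurable]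
  apply lintegral_congr
  intro l
  rw [← vol_aux t, Measure.restrict_apply
    (measurableSet_lt measurable_const (rearr_anti f).measurable)]
  congr 1
  ext s
  simp only [mem_inter_iff, mem_ofPred_eq, lt_rearr_iff]
  tauto

lemma layer_self (f : ℝ → ℝ≥0∞) (hf : Measurable f) (t : ℝ) :
    ∫⁻ s in Set.Ioo (0:ℝ) t, f s = ∫⁻ l in Set.Ioi (0:ℝ),
      volume {s ∈ Set.Ioo (0:ℝ) t | ENNReal.ofReal l < f s} := by
  rw [layer _ _ hf]
  apply lintegral_congr
  intro l
  rw [Measure.restrict_apply (measurableSet_lt measurable_const hf)]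
  congr 1
  ext s
  simp only [mem_inter_iff, mem_ofPred_eq]
  tauto

lemma rearr_int (f : ℝ → ℝ≥0∞) (hf : Measurable f) :
    ∫⁻ s in Set.Ioo (0:ℝ) 1, rearr f s = ∫⁻ s in Set.Ioo (0:ℝ) 1, f s := by
  rw [layer_rearr f 1, layer_self f hf 1]
  apply lintegral_congr
  intro l
  apply min_eq_right
  calc _ ≤ volume (Set.Ioo (0:ℝ) 1) := measure_mono (fun s hs => hs.1)
    _ = _ := by simp

lemma le_rearr_int (f : ℝ → ℝ≥0∞) (hf : Measurable f) (t : ℝ) (ht1 : t ≤ 1) :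
    ∫⁻ s in Set.Ioo (0:ℝ) t, f s ≤ ∫⁻ s in Set.Ioo (0:ℝ) t, rearr f s := by
  rw [layer_rearr f t, layer_self f hf t]
  apply lintegral_mono
  intro l
  apply le_min
  · calc _ ≤ volume (Set.Ioo (0:ℝ) t) := measure_mono (fun s hs => hs.1)
      _ = _ := by simp
  · exact measure_mono (fun s hs => ⟨⟨hs.1.1, hs.1.2.trans_le ht1⟩, hs.2⟩)

lemma rearr_int_le (f : ℝ → ℝ≥0∞) (hf : Measurable f) (t : ℝ) (ht1 : t < 1)
    (c : ℝ≥0∞) (hc : ∀ s ∈ Set.Ioo (0:ℝ) 1, t ≤ s → f s ≤ c) :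
    ∫⁻ s in Set.Ioo (0:ℝ) t, rearr f s ≤ (∫⁻ s in Set.Ioo (0:ℝ) t, f s) + c * ENNReal.ofReal t := by
  set k := Set.indicator (Set.Ioo (0:ℝ) t) f with hk
  have hkm : Measurable k := hf.indicator measurableSet_Ioo
  have h1 : ∀ s, rearr f s ≤ rearr k s + c := by
    intro s
    apply sInf_le
    have h2 : volume {x ∈ Set.Ioo (0:ℝ) 1 | rearr k s < k x} ≤ ENNReal.ofReal s := by
      by_contra h
      exact lt_irrefl _ ((lt_rearr_iff k _ s).mpr (not_le.mp h))
    refine le_trans (measure_mono ?_) h2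
    rintro x ⟨hx, hx2⟩
    refine ⟨hx, ?_⟩
    have hxt : x < t := by
      by_contra h
      exact absurd (hx2.trans_le (hc x hx (not_lt.mp h))) (not_lt.mpr le_add_self)
    rw [hk, Set.indicator_of_mem (show x ∈ Set.Ioo 0 t from ⟨hx.1, hxt⟩)]
    exact lt_of_le_of_lt le_self_add hx2
  calc ∫⁻ s in Set.Ioo (0:ℝ) t, rearr f s ≤ ∫⁻ s in Set.Ioo (0:ℝ) t, (rearr k s + c) :=
        lintegral_mono h1
    _ = (∫⁻ s in Set.Ioo (0:ℝ) t, rearr k s) + c * ENNReal.ofReal t := by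
        rw [lintegral_add_right _ measurable_const]
        simp
    _ ≤ (∫⁻ s in Set.Ioo (0:ℝ) 1, rearr k s) + c * ENNReal.ofReal t := by
        gcongr
    _ = _ := by
        rw [rearr_int k hkm, hk, setLIntegral_indicator measurableSet_Ioo]
        congr 3
        apply inter_eq_left.mpr
        exact Ioo_subset_Ioo le_rfl ht1.le


lemma nu_tail (F : ℝ → ℝ≥0∞) (hF : Antitone F) (ν : Measure ℝ)
    (hν : ∀ a b : ℝ, 0 < a → a ≤ b → b < 1 → ν (Set.Ioc a b) = F a - F b) (t : ℝ)
    (ht : t ∈ Set.Ioo (0:ℝ) 1) :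
    F t = ν (Set.Ioo t 1) + ⨅ n : ℕ, F (1 - 1 / ((n:ℝ) + 2)) := by
  have hb : ∀ n : ℕ, 1 - 1 / ((n:ℝ) + 2) < 1 := by
    intro n
    have : 0 < 1 / ((n:ℝ) + 2) := by positivity
    linarith
  have hlim : ∀ s : ℝ, s < 1 → ∃ n : ℕ, s ≤ 1 - 1 / ((n:ℝ) + 2) := by
    intro s hs
    obtain ⟨n, hn⟩ := exists_nat_one_div_lt (sub_pos.mpr hs)
    refine ⟨n, ?_⟩
    have : 1 / ((n:ℝ) + 2) ≤ 1 / ((n:ℝ) + 1) := by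
      apply one_div_le_one_div_of_le <;> [positivity; linarith]
    linarith
  have hU : Set.Ioo t 1 = ⋃ n : ℕ, Set.Ioc t (1 - 1 / ((n:ℝ) + 2)) := by
    ext s
    simp only [mem_Ioo, mem_iUnion, mem_Ioc]
    constructor
    · rintro ⟨h1, h2⟩
      obtain ⟨n, hn⟩ := hlim s h2
      exact ⟨n, h1, hn⟩
    · rintro ⟨n, h1, h2⟩
      exact ⟨h1, h2.trans_lt (hb n)⟩
  have hmono : Monotone fun n : ℕ => Set.Ioc t (1 - 1 / ((n:ℝ) + 2)) := by
    intro a b hab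
    apply Set.Ioc_subset_Ioc le_rfl
    have : 1 / ((b:ℝ) + 2) ≤ 1 / ((a:ℝ) + 2) := by
      apply one_div_le_one_div_of_le
      · positivity
      · have : (a:ℝ) ≤ b := by exact_mod_cast hab
        linarith
    linarith
  have hval : ∀ n : ℕ, ν (Set.Ioc t (1 - 1 / ((n:ℝ) + 2))) = F t - F (1 - 1 / ((n:ℝ) + 2)) := by
    intro n
    rcases le_total t (1 - 1 / ((n:ℝ) + 2)) with h | h
    · exact hν _ _ ht.1 h (hb n)
    · rw [Set.Ioc_eq_empty (not_lt.mpr h), measure_empty, tsub_eq_zero_of_le (hF h)]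
  rw [hU, hmono.measure_iUnion]
  simp_rw [hval]
  rw [← ENNReal.sub_iInf, tsub_add_cancel_of_le]
  obtain ⟨n, hn⟩ := hlim t ht.2
  exact (iInf_le _ n).trans (hF hn)

lemma nu_sfinite (F : ℝ → ℝ≥0∞) (hfin : ∀ t, 0 < t → F t ≠ ⊤) (ν : Measure ℝ)
    (hν : ∀ a b : ℝ, 0 < a → a ≤ b → b < 1 → ν (Set.Ioc a b) = F a - F b) :
    SigmaFinite (ν.restrict (Set.Ioo (0:ℝ) 1)) := by
  refine ⟨⟨⟨fun n : ℕ => Set.Ioc (1 / ((n:ℝ) + 2)) (1 - 1 / ((n:ℝ) + 2)) ∪ (Set.Ioo (0:ℝ) 1)ᶜ,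
    fun _ => trivial, ?_, ?_⟩⟩⟩
  · intro n
    have h0 : 0 < 1 / ((n:ℝ) + 2) := by positivity
    refine (measure_union_le _ _).trans_lt (ENNReal.add_lt_top.mpr ⟨?_, ?_⟩)
    · refine (Measure.restrict_apply_le _ _).trans_lt ?_
      rw [hν _ _ h0 ?_ (by linarith)]
      · exact tsub_le_self.trans_lt (lt_top_iff_ne_top.mpr (hfin _ h0))
      · have : 1 / ((n:ℝ) + 2) ≤ 1 / 2 := by
          apply one_div_le_one_div_of_le
          · positivity
          · have : (0:ℝ) ≤ n := by positivity
            linarith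
        linarith
    · rw [Measure.restrict_apply measurableSet_Ioo.compl]; simp
  · rw [Set.eq_univ_iff_forall]
    intro x
    by_cases hx : x ∈ Set.Ioo (0:ℝ) 1
    · obtain ⟨n, hn⟩ := exists_nat_one_div_lt (lt_min hx.1 (sub_pos.mpr hx.2))
      rw [mem_iUnion]
      refine ⟨n, Or.inl ?_⟩
      have : 1 / ((n:ℝ) + 2) ≤ 1 / ((n:ℝ) + 1) := by
        apply one_div_le_one_div_of_le <;> [positivity; linarith]
      rw [lt_min_iff] at hn
      constructor <;> linarith
    · rw [mem_iUnion]
      exact ⟨0, Or.inr hx⟩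

lemma nu_parts (F : ℝ → ℝ≥0∞) (hF : Antitone F) (hfin : ∀ t, 0 < t → F t ≠ ⊤) (ν : Measure ℝ)
    (hν : ∀ a b : ℝ, 0 < a → a ≤ b → b < 1 → ν (Set.Ioc a b) = F a - F b)
    (w : ℝ → ℝ≥0∞) (hw : Measurable w) :
    ∫⁻ t in Set.Ioo (0:ℝ) 1, F t * w t =
      (∫⁻ s in Set.Ioo (0:ℝ) 1, (∫⁻ t in Set.Ioo (0:ℝ) s, w t) ∂ν) +
      (⨅ n : ℕ, F (1 - 1 / ((n:ℝ) + 2))) * ∫⁻ t in Set.Ioo (0:ℝ) 1, w t := by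
  have hsf := nu_sfinite F hfin ν hν
  set L := ⨅ n : ℕ, F (1 - 1 / ((n:ℝ) + 2)) with hL
  set P : ℝ × ℝ → ℝ≥0∞ := Set.indicator {p : ℝ × ℝ | p.1 < p.2} (fun p => w p.1) with hP
  have hPm : Measurable P :=
    (hw.comp measurable_fst).indicator (measurableSet_lt measurable_fst measurable_snd)
  have h1 : ∀ t ∈ Set.Ioo (0:ℝ) 1, F t * w t =
      (∫⁻ s in Set.Ioo (0:ℝ) 1, P (t, s) ∂ν) + L * w t := by
    intro t ht
    have hPt : (fun s => P (t, s)) = Set.indicator (Set.Ioi t) (fun _ => w t) := by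
      ext s; simp [hP, Set.indicator]
    rw [hPt, setLIntegral_indicator measurableSet_Ioi, setLIntegral_const]
    have : Set.Ioi t ∩ Set.Ioo 0 1 = Set.Ioo t 1 := by
      ext s
      simp only [mem_inter_iff, mem_Ioi, mem_Ioo]
      constructor
      · rintro ⟨h1, h2, h3⟩; exact ⟨h1, h3⟩
      · rintro ⟨h1, h2⟩; exact ⟨h1, ht.1.trans h1, h2⟩
    rw [this, nu_tail F hF ν hν t ht]
    ring
  have hm2 : Measurable fun t => ∫⁻ s in Set.Ioo (0:ℝ) 1, P (t, s) ∂ν :=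
    Measurable.lintegral_prod_right hPm
  rw [setLIntegral_congr_fun measurableSet_Ioo h1, lintegral_add_left hm2,
    lintegral_const_mul _ hw, 
    lintegral_lintegral_swap (f := fun t s => P (t, s)) hPm.aemeasurable]
  congr 1
  apply setLIntegral_congr_fun measurableSet_Ioo
  intro s hs
  have hPs : (fun t => P (t, s)) = Set.indicator (Set.Iio s) w := by
    ext t; simp [hP, Set.indicator]
  simp only
  rw [hPs, setLIntegral_indicator measurableSet_Iio]
  congr 2
  ext t
  simp only [mem_inter_iff, mem_Iio, mem_Ioo]
  constructor
  · rintro ⟨h1, h2, h3⟩; exact ⟨h2, h1⟩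
  · rintro ⟨h1, h2⟩; exact ⟨h2, h1, h2.trans hs.2⟩

lemma assoc_mono (ρ : (ℝ → ℝ≥0∞) → ℝ≥0∞) (f g : ℝ → ℝ≥0∞)
    (h : ∀ t ∈ Set.Ioo (0:ℝ) 1, f t ≤ g t) : assoc ρ f ≤ assoc ρ g := by
  apply iSup₂_mono
  intro φ _
  apply setLIntegral_mono' measurableSet_Ioo
  intro t ht
  gcongr
  exact h t ht

lemma assoc_smul (ρ : (ℝ → ℝ≥0∞) → ℝ≥0∞) (c : ℝ≥0∞) (hc : c ≠ ⊤) (f : ℝ → ℝ≥0∞) :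
    assoc ρ (fun t => c * f t) ≤ c * assoc ρ f := by
  apply iSup₂_le
  intro φ hφ
  simp_rw [mul_assoc]
  rw [lintegral_const_mul' _ _ hc]
  gcongr
  exact le_iSup₂ (f := fun (φ : ℝ → ℝ≥0∞) (_ : Measurable φ ∧ ρ φ ≤ 1) =>
    ∫⁻ t in Set.Ioo (0:ℝ) 1, f t * φ t) φ hφ

lemma rho_le (ρ : (ℝ → ℝ≥0∞) → ℝ≥0∞) (hρ : IsRiNorm ρ) (ψ φ : ℝ → ℝ≥0∞) (hψ : Measurable ψ)
    (hφ : Measurable φ) (h : ∀ l, volume {s ∈ Set.Ioo (0:ℝ) 1 | l < ψ s} ≤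
      volume {s ∈ Set.Ioo (0:ℝ) 1 | l < φ s}) : ρ ψ ≤ ρ φ := by
  obtain ⟨-, -, -, hmono, -, -, -, hre⟩ := hρ
  rw [hre ψ hψ, hre φ hφ]
  apply hmono _ _ (rearr_anti _).measurable (rearr_anti _).measurable
  apply ae_of_all
  intro t
  apply sInf_le_sInf
  intro l hl
  exact (h l).trans hl

lemma affine_int (F : ℝ → ℝ≥0∞) (hF : Measurable F) (c : ℝ) :
    ∫⁻ y, F y = 2 * ∫⁻ x, F (2 * x - c) := by
  have h := lintegral_map (μ := volume) (f := fun y => F (y - c)) (g := fun x : ℝ => 2 * x)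
    (hF.comp (measurable_id.sub_const c)) (measurable_const_mul 2)
  rw [← h, Real.map_volume_mul_left two_ne_zero, lintegral_smul_measure,
    lintegral_sub_right_eq_self, smul_eq_mul, ← mul_assoc]
  have : (2:ℝ≥0∞) * ENNReal.ofReal |(2:ℝ)⁻¹| = 1 := by
    rw [abs_of_pos (by norm_num), ENNReal.ofReal_inv_of_pos two_pos, ENNReal.ofReal_ofNat,
      ENNReal.mul_inv_cancel two_ne_zero ENNReal.ofNat_ne_top]
  rw [this, one_mul]

lemma assoc_sup (ρ : (ℝ → ℝ≥0∞) → ℝ≥0∞) (hρ : IsRiNorm ρ) (R h : ℝ → ℝ≥0∞) (hh : Measurable h)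
    (r : ℕ → ℝ≥0∞)
    (hr : ∀ i : ℕ, ∀ x ∈ Set.Ioc ((1/2:ℝ)^(i+1)) ((1/2:ℝ)^i), x < 1 → r i ≤ R x)
    (hsel : ∀ y ∈ Set.Ioo (0:ℝ) 1, ∃ i : ℕ, y ≤ (1/2:ℝ)^i ∧ h y ≤ 4 * r i) :
    assoc ρ h ≤ 8 * assoc ρ R := by
  apply iSup₂_le
  rintro φ ⟨hφ, hφ1⟩
  set A : ℕ → Set ℝ := fun i => {y | h y ≤ 4 * r i} ∩ (Set.Ioo 0 1 ∩ Set.Iic ((1/2:ℝ)^i)) with hA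
  have hAm : ∀ i, MeasurableSet (A i) := fun i =>
    (measurableSet_le hh measurable_const).inter (measurableSet_Ioo.inter measurableSet_Iic)
  set C : ℕ → Set ℝ := disjointed A with hC
  have hCm : ∀ i, MeasurableSet (C i) := fun i => MeasurableSet.disjointed hAm i
  have hCd : Pairwise (Function.onFun Disjoint C) := disjoint_disjointed A
  have hCA : ∀ i, C i ⊆ A i := fun i => disjointed_subset A i
  have hCU : ⋃ i, C i = Set.Ioo 0 1 := by
    rw [hC, iUnion_disjointed]
    ext y
    rw [mem_iUnion]
    constructor
    · rintro ⟨i, hi⟩; exact hi.2.1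
    · intro hy
      obtain ⟨i, h1, h2⟩ := hsel y hy
      exact ⟨i, h2, hy, h1⟩
  set J : ℕ → Set ℝ := fun i => Set.Ioc ((1/2:ℝ)^(i+1)) ((1/2:ℝ)^i) ∩ Set.Ioo 0 1 with hJ
  have hJm : ∀ i, MeasurableSet (J i) := fun i => measurableSet_Ioc.inter measurableSet_Ioo
  have hJd : Pairwise (Function.onFun Disjoint J) := by
    have key : ∀ i j, i < j → Disjoint (J i) (J j) := by
      intro i j hij
      rw [Set.disjoint_left]
      rintro x ⟨hx, _⟩ ⟨hx', _⟩
      have : (1/2:ℝ)^j ≤ (1/2:ℝ)^(i+1) := pow_le_pow_of_le_one (by norm_num) (by norm_num) hij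
      linarith [hx.1, hx'.2]
    intro i j hij
    rcases lt_or_gt_of_ne hij with h | h
    · exact key i j h
    · exact (key j i h).symm
  set T : ℕ → ℝ → ℝ≥0∞ := fun i x => Set.indicator (C i) φ (2 * x - (1/2:ℝ)^i) with hT
  have hTm : ∀ i, Measurable (T i) := fun i =>
    (hφ.indicator (hCm i)).comp ((measurable_const_mul 2).sub_const _)
  set ψ : ℝ → ℝ≥0∞ := fun x => ⨆ i, T i x with hψ
  have hψm : Measurable ψ := Measurable.iSup hTm
  have hsupp : ∀ i x, 2 * x - (1/2:ℝ)^i ∈ C i → x ∈ J i := by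
    intro i x hx
    obtain ⟨-, ⟨h1, h2⟩, h3⟩ := hCA i hx
    have hp : (0:ℝ) < (1/2:ℝ)^i := by positivity
    have hp1 : (1/2:ℝ)^i ≤ 1 := pow_le_one₀ (by norm_num) (by norm_num)
    rw [mem_Iic] at h3
    refine ⟨⟨?_, ?_⟩, ?_, ?_⟩
    · rw [pow_succ]; linarith
    · linarith
    · linarith
    · linarith
  have hψρ : ρ ψ ≤ 1 := by
    refine (rho_le ρ hρ ψ φ hψm hφ ?_).trans hφ1
    intro l
    have hS : MeasurableSet {y | l < φ y} := measurableSet_lt measurable_const hφ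
    calc volume {s ∈ Set.Ioo (0:ℝ) 1 | l < ψ s}
        ≤ volume (⋃ i, (fun x : ℝ => 2 * x - (1/2:ℝ)^i) ⁻¹' (C i ∩ {y | l < φ y})) := by
          apply measure_mono
          rintro x ⟨hx, hx2⟩
          obtain ⟨i, hi⟩ := lt_iSup_iff.mp hx2
          rw [mem_iUnion]
          refine ⟨i, ?_⟩
          by_cases hm : 2 * x - (1/2:ℝ)^i ∈ C i
          · simp only [hT, Set.indicator_of_mem hm] at hi
            exact ⟨hm, hi⟩
          · simp only [hT, Set.indicator_of_notMem hm] at hi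
            exact absurd hi not_lt_zero
      _ ≤ ∑' i, volume ((fun x : ℝ => 2 * x - (1/2:ℝ)^i) ⁻¹' (C i ∩ {y | l < φ y})) :=
          measure_iUnion_le _
      _ ≤ ∑' i, volume (C i ∩ {y | l < φ y}) := by
          apply ENNReal.tsum_le_tsum
          intro i
          have hm := (hCm i).inter hS
          rw [← lintegral_indicator_one hm, affine_int _ (measurable_one.indicator hm) ((1/2:ℝ)^i),
            ← lintegral_indicator_one
              (((measurable_const_mul (2:ℝ)).sub_const ((1/2:ℝ)^i)) hm), two_mul]
          exact le_self_add
      _ = volume (⋃ i, (C i ∩ {y | l < φ y})) := by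
          rw [measure_iUnion]
          · intro i j hij
            exact (hCd hij).mono inter_subset_left inter_subset_left
          · exact fun i => (hCm i).inter hS
      _ = _ := by
          rw [← Set.iUnion_inter, hCU]; rfl
  calc ∫⁻ t in Set.Ioo (0:ℝ) 1, h t * φ t = ∑' i, ∫⁻ t in C i, h t * φ t := by
        rw [← hCU, lintegral_iUnion hCm hCd]
    _ ≤ ∑' i, 8 * ∫⁻ x in J i, R x * ψ x := by
        apply ENNReal.tsum_le_tsum
        intro i
        calc ∫⁻ t in C i, h t * φ t ≤ ∫⁻ t in C i, (4 * r i) * φ t := by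
              apply setLIntegral_mono' (hCm i)
              intro t ht
              gcongr
              exact (hCA i ht).1
          _ = (4 * r i) * ∫⁻ t, Set.indicator (C i) φ t := by
              rw [lintegral_const_mul _ hφ, lintegral_indicator (hCm i)]
          _ = (4 * r i) * (2 * ∫⁻ x in J i, T i x) := by
              rw [affine_int _ (hφ.indicator (hCm i)) ((1/2:ℝ)^i)]
              congr 2
              rw [← lintegral_indicator (hJm i)]
              apply lintegral_congr
              intro x
              by_cases hx : x ∈ J i
              · rw [Set.indicator_of_mem hx]
              · rw [Set.indicator_of_notMem hx, Set.indicator_of_notMem]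
                exact fun h => hx (hsupp i x h)
          _ = 8 * ∫⁻ x in J i, r i * T i x := by
              rw [lintegral_const_mul _ (hTm i)]
              ring
          _ ≤ 8 * ∫⁻ x in J i, R x * ψ x := by
              gcongr 8 * ?_
              apply setLIntegral_mono' (hJm i)
              intro x hx
              exact mul_le_mul' (hr i x hx.1 hx.2.2) (le_iSup (fun i => T i x) i)
    _ = 8 * ∫⁻ x in ⋃ i, J i, R x * ψ x := by
        rw [ENNReal.tsum_mul_left, lintegral_iUnion hJm hJd]
    _ ≤ 8 * ∫⁻ x in Set.Ioo (0:ℝ) 1, R x * ψ x := by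
        gcongr
        exact iUnion_subset fun i => inter_subset_right
    _ ≤ 8 * assoc ρ R := by
        gcongr
        exact le_iSup₂ (f := fun (φ : ℝ → ℝ≥0∞) (_ : Measurable φ ∧ ρ φ ≤ 1) =>
          ∫⁻ t in Set.Ioo (0:ℝ) 1, R t * φ t) ψ ⟨hψm, hψρ⟩

lemma I_pos {I : ℝ → ℝ} (hqc : Quasiconcave I) {t : ℝ} (ht : t ∈ Set.Ioo (0:ℝ) 1) : 0 < I t :=
  (hqc.1.mapsTo ht).1

lemma I_lt_one {I : ℝ → ℝ} (hqc : Quasiconcave I) {t : ℝ} (ht : t ∈ Set.Ioo (0:ℝ) 1) : I t < 1 :=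
  (hqc.1.mapsTo ht).2

lemma I_quasi {I : ℝ → ℝ} (hqc : Quasiconcave I) {a x : ℝ} (ha : a ∈ Set.Ioo (0:ℝ) 1)
    (hx : x ∈ Set.Ioo (0:ℝ) 1) (hax : a ≤ x) : I x * a ≤ I a * x := by
  have := hqc.2.2.1 ha hx hax
  simp only at this
  rwa [div_le_div_iff₀ hx.1 ha.1] at this

lemma I_ge {I : ℝ → ℝ} (hqc : Quasiconcave I) {t : ℝ} (ht : t ∈ Set.Ioo (0:ℝ) 1) : t ≤ I t := by
  have hne : (nhdsWithin (1:ℝ) (Set.Ioo 0 1)).NeBot := by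
    rw [← mem_closure_iff_nhdsWithin_neBot, closure_Ioo (by norm_num)]
    exact ⟨zero_le_one, le_rfl⟩
  have hlim : Tendsto (fun s => I s * t) (nhdsWithin 1 (Set.Ioo 0 1)) (nhds (1 * t)) :=
    hqc.2.2.2.2.mul_const t
  have hev : ∀ᶠ s in nhdsWithin (1:ℝ) (Set.Ioo 0 1), I s * t ≤ I t := by
    filter_upwards [self_mem_nhdsWithin, nhdsWithin_le_nhds (Ioi_mem_nhds ht.2)] with s hs hs2
    have h1 := I_quasi hqc ht hs (le_of_lt hs2)
    have h2 : I t * s ≤ I t * 1 := mul_le_mul_of_nonneg_left hs.2.le (I_pos hqc ht).le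
    linarith
  have := le_of_tendsto hlim hev
  linarith

lemma G_double (γ : ℝ → ℝ≥0∞) (hγ : Antitone γ) (a x : ℝ) (hx : x ≤ 2 * a) :
    ∫⁻ s in Set.Ioo (0:ℝ) x, γ s ≤ 2 * ∫⁻ s in Set.Ioo (0:ℝ) a, γ s := by
  have hsub : Set.Ioo (0:ℝ) x ⊆ Set.Ioo 0 a ∪ Set.Ico a x := by
    intro s hs
    rcases lt_or_ge s a with h | h
    · exact Or.inl ⟨hs.1, h⟩
    · exact Or.inr ⟨h, hs.2⟩
  calc ∫⁻ s in Set.Ioo (0:ℝ) x, γ s ≤ ∫⁻ s in Set.Ioo 0 a ∪ Set.Ico a x, γ s :=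
        lintegral_mono_set hsub
    _ ≤ (∫⁻ s in Set.Ioo 0 a, γ s) + ∫⁻ s in Set.Ico a x, γ s := lintegral_union_le _ _ _
    _ ≤ (∫⁻ s in Set.Ioo 0 a, γ s) + ∫⁻ s in Set.Ico a x, γ a := by
        gcongr 1
        exact setLIntegral_mono' measurableSet_Ico (fun s hs => hγ hs.1)
    _ ≤ (∫⁻ s in Set.Ioo 0 a, γ s) + ∫⁻ s in Set.Ioo 0 a, γ a := by
        gcongr 1
        simp only [setLIntegral_const, Real.volume_Ico, Real.volume_Ioo]
        apply mul_le_mul' le_rfl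
        apply ENNReal.ofReal_le_ofReal
        linarith
    _ ≤ (∫⁻ s in Set.Ioo 0 a, γ s) + ∫⁻ s in Set.Ioo 0 a, γ s := by
        gcongr 1
        exact setLIntegral_mono' measurableSet_Ioo (fun s hs => hγ hs.2.le)
    _ = _ := (two_mul _).symm

lemma R_lower {I : ℝ → ℝ} (hqc : Quasiconcave I) (γ : ℝ → ℝ≥0∞) {a x : ℝ}
    (ha : a ∈ Set.Ioo (0:ℝ) 1) (hx : x ∈ Set.Ioo (0:ℝ) 1) (hax : a ≤ x) (hx2 : x ≤ 2 * a) :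
    RI I γ a ≤ 2 * RI I γ x := by
  have h1 : I x ≤ 2 * I a := by
    have h1 := I_quasi hqc ha hx hax
    have h2 : I a * x ≤ I a * (2 * a) := mul_le_mul_of_nonneg_left hx2 (I_pos hqc ha).le
    have h3 : I x * a ≤ (2 * I a) * a := by linarith
    exact le_of_mul_le_mul_right h3 ha.1
  have h2 : (ENNReal.ofReal (I a))⁻¹ ≤ 2 * (ENNReal.ofReal (I x))⁻¹ := by
    rw [← ENNReal.ofReal_inv_of_pos (I_pos hqc ha), ← ENNReal.ofReal_inv_of_pos (I_pos hqc hx),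
      show (2:ℝ≥0∞) = ENNReal.ofReal 2 by simp, ← ENNReal.ofReal_mul zero_le_two]
    apply ENNReal.ofReal_le_ofReal
    have hpa := I_pos hqc ha
    have hpx := I_pos hqc hx
    rw [← div_eq_mul_inv, inv_eq_one_div, div_le_div_iff₀ hpa hpx]
    linarith
  unfold RI
  rw [← mul_assoc]
  exact mul_le_mul' h2 (lintegral_mono_set (Set.Ioo_subset_Ioo le_rfl hax))

lemma R_upper {I : ℝ → ℝ} (hqc : Quasiconcave I) (γ : ℝ → ℝ≥0∞) (hγ : Antitone γ) {a x : ℝ}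
    (ha : a ∈ Set.Ioo (0:ℝ) 1) (hx : x ∈ Set.Ioo (0:ℝ) 1) (hax : a ≤ x) (hx2 : x ≤ 2 * a) :
    RI I γ x ≤ 2 * RI I γ a := by
  unfold RI
  rw [mul_left_comm]
  apply mul_le_mul'
  · rw [ENNReal.inv_le_inv]
    exact ENNReal.ofReal_le_ofReal (hqc.2.1 ha hx hax)
  · exact G_double γ hγ a x hx2

lemma anti_rearr_le (h : ℝ → ℝ≥0∞) (hh : Antitone h) (t : ℝ) :
    rearr h t ≤ h t := by
  apply sInf_le
  calc volume {s ∈ Set.Ioo (0:ℝ) 1 | h t < h s} ≤ volume (Set.Ioo 0 t) := by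
        apply measure_mono
        rintro s ⟨hs, hs2⟩
        refine ⟨hs.1, ?_⟩
        by_contra hc
        exact absurd (hh (not_lt.mp hc)) (not_le.mpr hs2)
    _ = ENNReal.ofReal t := by simp

lemma exists_h {I : ℝ → ℝ} (hqc : Quasiconcave I) (ρ : (ℝ → ℝ≥0∞) → ℝ≥0∞) (hρ : IsRiNorm ρ)
    (γ : ℝ → ℝ≥0∞) (hγ : Antitone γ) (hg : assoc ρ (RI I γ) ≤ 1) :
    ∃ h : ℝ → ℝ≥0∞, (Measurable h ∧ assoc ρ (SI I h) ≤ 1) ∧ ∀ t ∈ Set.Ioo (0:ℝ) 1,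
      ∫⁻ s in Set.Ioo (0:ℝ) t, γ s ≤ 16 * (ENNReal.ofReal (I t) * rearr h t) := by
  set R := RI I γ with hR
  set H : ℝ → ℝ≥0∞ := fun t => ⨆ (s : ℝ) (_ : t ≤ s ∧ s ∈ Set.Ioo (0:ℝ) 1), R s with hH
  have hHanti : Antitone H := by
    intro a b hab
    apply iSup₂_le
    intro s hs
    exact le_iSup₂ (f := fun (s : ℝ) (_ : a ≤ s ∧ s ∈ Set.Ioo (0:ℝ) 1) => R s) s
      ⟨hab.trans hs.1, hs.2⟩
  have hRH : ∀ t s, t ≤ s → s ∈ Set.Ioo (0:ℝ) 1 → R s ≤ H t := by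
    intro t s h1 h2
    exact le_iSup₂ (f := fun (s : ℝ) (_ : t ≤ s ∧ s ∈ Set.Ioo (0:ℝ) 1) => R s) s ⟨h1, h2⟩
  have hpow : ∀ i : ℕ, (1/2:ℝ)^(i+1) ∈ Set.Ioo (0:ℝ) 1 := fun i =>
    ⟨by positivity, pow_lt_one₀ (by norm_num) (by norm_num) (by omega)⟩
  have hHR : assoc ρ H ≤ 8 * assoc ρ R := by
    apply assoc_sup ρ hρ R H hHanti.measurable (fun i => R ((1/2:ℝ)^(i+1)) / 2)
    · intro i x hx hx1
      have hx0 : x ∈ Set.Ioo (0:ℝ) 1 := ⟨(hpow i).1.trans hx.1, hx1⟩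
      have := R_lower hqc γ (hpow i) hx0 hx.1.le (by
        have := hx.2
        rw [pow_succ]; linarith)
      exact ENNReal.div_le_of_le_mul' this
    · intro y hy
      obtain ⟨N, hN⟩ := exists_pow_lt_of_lt_one hy.1 (show (1/2:ℝ) < 1 by norm_num)
      set S := (Finset.range N).filter (fun i => y ≤ (1/2:ℝ)^i) with hS
      have hmem : ∀ i : ℕ, y ≤ (1/2:ℝ)^i → i ∈ S := by
        intro i hi
        rw [hS, Finset.mem_filter, Finset.mem_range]
        refine ⟨?_, hi⟩
        by_contra hc
        have : (1/2:ℝ)^i ≤ (1/2:ℝ)^N :=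
          pow_le_pow_of_le_one (by norm_num) (by norm_num) (not_lt.mp hc)
        linarith
      have hne : S.Nonempty := ⟨0, hmem 0 (by simpa using hy.2.le)⟩
      obtain ⟨i, hi, hmax⟩ := S.exists_max_image (fun i => R ((1/2:ℝ)^(i+1)) / 2) hne
      refine ⟨i, (Finset.mem_filter.mp hi).2, ?_⟩
      apply iSup₂_le
      rintro s ⟨hys, hs⟩
      obtain ⟨j, hj1, hj2⟩ := exists_nat_pow_near_of_lt_one hs.1 hs.2.le
        (show (0:ℝ) < 1/2 by norm_num) (show (1/2:ℝ) < 1 by norm_num)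
      have h1 := R_upper hqc γ hγ (hpow j) hs hj1.le (by rw [pow_succ]; linarith)
      have h2 := hmax j (hmem j (hys.trans hj2))
      calc R s ≤ 2 * R ((1/2:ℝ)^(j+1)) := h1
        _ = 4 * (R ((1/2:ℝ)^(j+1)) / 2) := by
          rw [show (4:ℝ≥0∞) = 2 * 2 by norm_num, mul_assoc,
            ENNReal.mul_div_cancel two_ne_zero ENNReal.ofNat_ne_top]
        _ ≤ _ := by gcongr
  set h : ℝ → ℝ≥0∞ := fun t => 8⁻¹ * H t with hh
  have hhanti : Antitone h := fun a b hab => mul_le_mul' le_rfl (hHanti hab)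
  refine ⟨h, ⟨hhanti.measurable, ?_⟩, ?_⟩
  · have h1 : ∀ t ∈ Set.Ioo (0:ℝ) 1, SI I h t ≤ 8⁻¹ * H t := by
      intro t ht
      have hIt : ENNReal.ofReal (I t) ≠ 0 := by
        simpa using I_pos hqc ht
      unfold SI
      rw [ENNReal.inv_mul_le_iff hIt ENNReal.ofReal_ne_top]
      apply iSup₂_le
      intro s hs
      have hs1 : s ∈ Set.Ioo (0:ℝ) 1 := ⟨hs.1, hs.2.trans_lt ht.2⟩
      calc ENNReal.ofReal (I s) * rearr h s ≤ ENNReal.ofReal (I s) * (8⁻¹ * H s) := by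
            gcongr
            exact anti_rearr_le h hhanti s
        _ = 8⁻¹ * (ENNReal.ofReal (I s) * H s) := by ring
        _ ≤ 8⁻¹ * (ENNReal.ofReal (I t) * H t) := by
            gcongr 8⁻¹ * ?_
            have hHs : H s = ⨆ (q : ℝ) (_ : s ≤ q ∧ q ∈ Set.Ioo (0:ℝ) 1), R q := rfl
            rw [hHs]
            simp only [ENNReal.mul_iSup]
            apply iSup₂_le
            rintro q ⟨hsq, hq⟩
            rcases le_total t q with htq | hqt
            · exact mul_le_mul' (ENNReal.ofReal_le_ofReal (hqc.2.1 hs1 ht hs.2)) (hRH t q htq hq)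
            · calc ENNReal.ofReal (I s) * R q ≤ ENNReal.ofReal (I q) * R q := by
                    gcongr
                    exact hqc.2.1 hs1 hq hsq
                _ ≤ ENNReal.ofReal (I t) * R t := by
                    rw [hR]
                    unfold RI
                    rw [← mul_assoc, ← mul_assoc, ENNReal.mul_inv_cancel (by simpa using I_pos hqc hq)
                      ENNReal.ofReal_ne_top, ENNReal.mul_inv_cancel hIt ENNReal.ofReal_ne_top]
                    gcongr
                _ ≤ ENNReal.ofReal (I t) * H t := by
                    gcongr
                    exact hRH t t le_rfl ht
        _ = _ := by ring
    calc assoc ρ (SI I h) ≤ assoc ρ (fun t => 8⁻¹ * H t) := assoc_mono ρ _ _ h1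
      _ ≤ 8⁻¹ * assoc ρ H := assoc_smul ρ _ (by simp) H
      _ ≤ 8⁻¹ * (8 * 1) := by gcongr; exact hHR.trans (by gcongr)
      _ = 1 := by rw [mul_one, ENNReal.inv_mul_cancel (by norm_num) (by norm_num)]
  · intro t ht
    have hIt : ENNReal.ofReal (I t) ≠ 0 := by
      simpa using I_pos hqc ht
    have h1 : R t / 16 ≤ rearr h t := by
      apply le_of_forall_lt
      intro l hl
      rw [lt_rearr_iff]
      set b := min (2 * t) ((t + 1) / 2) with hb
      have ht0 := ht.1
      have ht1 := ht.2
      have htb : t < b := lt_min (by linarith) (by linarith)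
      have hb1 : b < 1 := (min_le_right _ _).trans_lt (by linarith)
      have hb2 : b ≤ 2 * t := min_le_left _ _
      have hbI : b ∈ Set.Ioo (0:ℝ) 1 := ⟨ht0.trans htb, hb1⟩
      calc ENNReal.ofReal t < ENNReal.ofReal b := (ENNReal.ofReal_lt_ofReal_iff hbI.1).mpr htb
        _ = volume (Set.Ioo 0 b) := by simp
        _ ≤ _ := by
          apply measure_mono
          intro s hs
          refine ⟨⟨hs.1, hs.2.trans hb1⟩, hl.trans_le ?_⟩
          calc R t / 16 ≤ (2 * R b) / 16 := by
                gcongr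
                exact R_lower hqc γ ht hbI htb.le hb2
            _ = 8⁻¹ * R b := by
                rw [show (16:ℝ≥0∞) = 2 * 8 by norm_num,
                  ENNReal.mul_div_mul_left _ _ two_ne_zero ENNReal.ofNat_ne_top,
                  ENNReal.div_eq_inv_mul]
            _ ≤ h s := mul_le_mul' le_rfl (hRH s b hs.2.le hbI)
    calc ∫⁻ s in Set.Ioo (0:ℝ) t, γ s = ENNReal.ofReal (I t) * R t := by
          rw [hR]; unfold RI
          rw [← mul_assoc, ENNReal.mul_inv_cancel hIt ENNReal.ofReal_ne_top, one_mul]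
      _ = 16 * (ENNReal.ofReal (I t) * (R t / 16)) := by
          rw [mul_left_comm, ENNReal.mul_div_cancel (by norm_num) (by norm_num)]
      _ ≤ _ := by gcongr

lemma exists_k (K : ℝ → ℝ≥0∞) (hK : Monotone K) (hK0 : ∀ t ≤ 0, K t = 0)
    (hfin : ∀ t ∈ Set.Ioo (0:ℝ) 1, K t ≠ ⊤)
    (hq : ∀ r ∈ Set.Ioo (0:ℝ) 1, ∀ s ∈ Set.Ioo (0:ℝ) 1, r ≤ s →
      K s * ENNReal.ofReal r ≤ K r * ENNReal.ofReal s) (δ : ℝ) (hδ : 0 < δ) :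
    ∃ k : ℝ → ℝ≥0∞, Measurable k ∧
      (∀ t ∈ Set.Ioo (0:ℝ) 1, ∫⁻ s in Set.Ioo (0:ℝ) t, rearr k s ≤ K t) ∧
      (∀ t ∈ Set.Ioo (0:ℝ) 1, 2 * δ ≤ t → K t ≤ 4 * ∫⁻ s in Set.Ioo (0:ℝ) t, rearr k s) := by
  set D := ENNReal.ofReal δ with hD
  have hD0 : D ≠ 0 := by simpa [hD] using hδ
  have hDt : D ≠ ⊤ := ENNReal.ofReal_ne_top
  set k : ℝ → ℝ≥0∞ := fun s => (2 * D)⁻¹ * (K s - K (s - δ)) with hk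
  have hED : (2 * D)⁻¹ * D = 2⁻¹ := by
    rw [ENNReal.mul_inv (Or.inl two_ne_zero) (Or.inl ENNReal.ofNat_ne_top), mul_assoc,
      ENNReal.inv_mul_cancel hD0 hDt, mul_one]
  have hKs : Measurable fun s => K (s - δ) := hK.measurable.comp (measurable_id.sub_const δ)
  have hdm : Measurable fun s => K s - K (s - δ) := hK.measurable.sub hKs
  have hkm : Measurable k := hdm.const_mul _
  have hshift : ∀ t, ∫⁻ s in Set.Ioo (0:ℝ) t, K (s - δ) = ∫⁻ s in Set.Ioo (0:ℝ) (t - δ), K s := by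
    intro t
    rw [← lintegral_indicator measurableSet_Ioo, ← lintegral_indicator measurableSet_Ioo,
      ← lintegral_sub_right_eq_self ((Set.Ioo (0:ℝ) (t - δ)).indicator fun s => K s) δ]
    apply lintegral_congr
    intro s
    simp only [Set.indicator, mem_Ioo]
    by_cases h1 : s ≤ δ
    · rw [hK0 (s - δ) (by linarith)]; simp
    · push Not at h1
      have e1 : 0 < s - δ := by linarith
      have e2 : 0 < s := by linarith
      simp [e1, e2, h1]
  have hB : ∀ t ∈ Set.Ioo (0:ℝ) 1, ∫⁻ s in Set.Ioo (0:ℝ) t, K (s - δ) ≠ ⊤ := by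
    intro t ht
    have : ∫⁻ s in Set.Ioo (0:ℝ) t, K (s - δ) ≤ ∫⁻ s in Set.Ioo (0:ℝ) t, K t :=
      setLIntegral_mono' measurableSet_Ioo (fun s hs => hK (by linarith [hs.2]))
    refine ne_top_of_le_ne_top ?_ this
    rw [setLIntegral_const]
    exact ENNReal.mul_ne_top (hfin t ht) (by simp)
  have hN : ∀ t ∈ Set.Ioo (0:ℝ) 1, ∫⁻ s in Set.Ioo (0:ℝ) t, (K s - K (s - δ)) =
      (∫⁻ s in Set.Ioo (0:ℝ) t, K s) - ∫⁻ s in Set.Ioo (0:ℝ) t, K (s - δ) := fun t ht =>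
    lintegral_sub' hKs.aemeasurable (hB t ht) (ae_of_all _ fun s => hK (by linarith))
  have hup : ∀ t ∈ Set.Ioo (0:ℝ) 1, ∫⁻ s in Set.Ioo (0:ℝ) t, (K s - K (s - δ)) ≤ D * K t := by
    intro t ht
    rw [hN t ht, tsub_le_iff_right, hshift]
    have hsub : Set.Ioo (0:ℝ) t ⊆ Set.Ico (t - δ) t ∪ Set.Ioo 0 (t - δ) := by
      intro s hs
      rcases lt_or_ge s (t - δ) with h | h
      · exact Or.inr ⟨hs.1, h⟩
      · exact Or.inl ⟨h, hs.2⟩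
    refine (lintegral_mono_set hsub).trans ((lintegral_union_le _ _ _).trans ?_)
    gcongr 1
    calc ∫⁻ s in Set.Ico (t - δ) t, K s ≤ ∫⁻ s in Set.Ico (t - δ) t, K t :=
          setLIntegral_mono' measurableSet_Ico (fun s hs => hK hs.2.le)
      _ = D * K t := by
          rw [setLIntegral_const, Real.volume_Ico, sub_sub_cancel, mul_comm]
  have hlow : ∀ t ∈ Set.Ioo (0:ℝ) 1, 2 * δ ≤ t →
      D * K t ≤ 2 * ∫⁻ s in Set.Ioo (0:ℝ) t, (K s - K (s - δ)) := by
    intro t ht h2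
    have h1 : D * K (t - δ) ≤ ∫⁻ s in Set.Ioo (0:ℝ) t, (K s - K (s - δ)) := by
      rw [hN t ht]
      apply ENNReal.le_sub_of_add_le_right (hB t ht)
      rw [hshift]
      have hdis : Disjoint (Set.Ico (t - δ) t) (Set.Ioo 0 (t - δ)) := by
        rw [Set.disjoint_left]
        intro s hs hs2
        linarith [hs.1, hs2.2]
      have hsub : Set.Ico (t - δ) t ∪ Set.Ioo 0 (t - δ) ⊆ Set.Ioo (0:ℝ) t := by
        rintro s (hs | hs)
        · exact ⟨by linarith [hs.1], hs.2⟩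
        · exact ⟨hs.1, by linarith [hs.2]⟩
      refine le_trans ?_ (lintegral_mono_set hsub)
      rw [lintegral_union measurableSet_Ioo hdis]
      gcongr 1
      calc D * K (t - δ) = ∫⁻ s in Set.Ico (t - δ) t, K (t - δ) := by
            rw [setLIntegral_const, Real.volume_Ico, sub_sub_cancel, mul_comm]
        _ ≤ _ := setLIntegral_mono' measurableSet_Ico (fun s hs => hK hs.1)
    have h3 : K t ≤ 2 * K (t - δ) := by
      have htd : t - δ ∈ Set.Ioo (0:ℝ) 1 := ⟨by linarith, by linarith [ht.2]⟩
      have h4 := hq (t - δ) htd t ht (by linarith)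
      have hT0 : ENNReal.ofReal (t - δ) ≠ 0 := by simpa using htd.1
      rw [← ENNReal.mul_le_mul_iff_left hT0 ENNReal.ofReal_ne_top]
      refine h4.trans ?_
      have : ENNReal.ofReal t ≤ 2 * ENNReal.ofReal (t - δ) := by
        rw [show (2:ℝ≥0∞) = ENNReal.ofReal 2 by simp, ← ENNReal.ofReal_mul zero_le_two]
        apply ENNReal.ofReal_le_ofReal
        linarith
      calc K (t - δ) * ENNReal.ofReal t ≤ K (t - δ) * (2 * ENNReal.ofReal (t - δ)) := by gcongr
        _ = _ := by ring
    calc D * K t ≤ D * (2 * K (t - δ)) := by gcongr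
      _ = 2 * (D * K (t - δ)) := by ring
      _ ≤ _ := by gcongr
  have hki : ∀ t, ∫⁻ s in Set.Ioo (0:ℝ) t, k s =
      (2 * D)⁻¹ * ∫⁻ s in Set.Ioo (0:ℝ) t, (K s - K (s - δ)) := fun t =>
    lintegral_const_mul _ hdm
  refine ⟨k, hkm, ?_, ?_⟩
  · intro t ht
    have hT0 : ENNReal.ofReal t ≠ 0 := by simpa using ht.1
    have hTt : ENNReal.ofReal t ≠ ⊤ := ENNReal.ofReal_ne_top
    set c := K t / ENNReal.ofReal t with hc
    have hcK : c * ENNReal.ofReal t = K t := ENNReal.div_mul_cancel hT0 hTt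
    have hpt : ∀ s ∈ Set.Ioo (0:ℝ) 1, t ≤ s → K s - K (s - δ) ≤ D * c := by
      intro s hs hts
      have hS0 : ENNReal.ofReal s ≠ 0 := by simpa using hs.1
      have h1 : K s ≤ c * ENNReal.ofReal s := by
        rw [← ENNReal.mul_le_mul_iff_left hT0 hTt]
        calc K s * ENNReal.ofReal t ≤ K t * ENNReal.ofReal s := hq t ht s hs hts
          _ = _ := by rw [← hcK]; ring
      rcases le_or_gt s δ with h | h
      · calc K s - K (s - δ) ≤ K s := tsub_le_self
          _ ≤ c * ENNReal.ofReal s := h1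
          _ ≤ c * D := by gcongr; exact ENNReal.ofReal_le_ofReal h
          _ = _ := mul_comm _ _
      · rw [tsub_le_iff_right, ← ENNReal.mul_le_mul_iff_left hS0 ENNReal.ofReal_ne_top]
        have hsd : s - δ ∈ Set.Ioo (0:ℝ) 1 := ⟨by linarith, by linarith [hs.2]⟩
        have hsplit : ENNReal.ofReal s = D + ENNReal.ofReal (s - δ) := by
          rw [hD, ← ENNReal.ofReal_add hδ.le hsd.1.le]; congr 1; ring
        calc K s * ENNReal.ofReal s = K s * D + K s * ENNReal.ofReal (s - δ) := by
              rw [← mul_add, ← hsplit]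
          _ ≤ (c * ENNReal.ofReal s) * D + K (s - δ) * ENNReal.ofReal s := by
              gcongr 1
              · gcongr
              · exact hq _ hsd _ hs (by linarith)
          _ = _ := by ring
    have hkc : ∀ s ∈ Set.Ioo (0:ℝ) 1, t ≤ s → k s ≤ 2⁻¹ * c := by
      intro s hs hts
      calc k s ≤ (2 * D)⁻¹ * (D * c) := mul_le_mul' le_rfl (hpt s hs hts)
        _ = 2⁻¹ * c := by rw [← mul_assoc, hED]
    refine (rearr_int_le k hkm t ht.2 _ hkc).trans ?_
    rw [hki, mul_assoc, hcK]
    calc (2 * D)⁻¹ * (∫⁻ s in Set.Ioo (0:ℝ) t, (K s - K (s - δ))) + 2⁻¹ * K t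
        ≤ (2 * D)⁻¹ * (D * K t) + 2⁻¹ * K t := by
          gcongr
          exact hup t ht
      _ = K t := by
          rw [← mul_assoc, hED, ← add_mul, ENNReal.inv_two_add_inv_two, one_mul]
  · intro t ht h2
    calc K t = 2 * ((2 * D)⁻¹ * (D * K t)) := by
          rw [← mul_assoc (2 * D)⁻¹, hED, ← mul_assoc, ENNReal.mul_inv_cancel two_ne_zero
            ENNReal.ofNat_ne_top, one_mul]
      _ ≤ 2 * ((2 * D)⁻¹ * (2 * ∫⁻ s in Set.Ioo (0:ℝ) t, (K s - K (s - δ)))) := by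
          gcongr 2 * ((2 * D)⁻¹ * ?_)
          exact hlow t ht h2
      _ = 4 * ∫⁻ s in Set.Ioo (0:ℝ) t, k s := by
          rw [hki]; ring
      _ ≤ _ := by
          gcongr 4 * ?_
          exact le_rearr_int k hkm t ht.2.le

lemma int_le_rho (ρ : (ℝ → ℝ≥0∞) → ℝ≥0∞) (hρ : IsRiNorm ρ) (u : ℝ → ℝ≥0∞)
    (hu : assoc ρ u ≤ 1) : ∫⁻ t in Set.Ioo (0:ℝ) 1, u t ≤ ρ (fun _ => 1) := by
  obtain ⟨h0, hsc, -, -, -, hfin, -, -⟩ := hρ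
  set q := ρ (fun _ => 1) with hq
  have hq0 : q ≠ 0 := by
    intro h
    have := (h0 (fun _ => 1) measurable_const).mp h
    rw [Filter.EventuallyEq, ae_iff] at this
    simp at this
  have hqt : q ≠ ⊤ := hfin.ne
  have h1 := hsc (fun _ => 1) measurable_const (q⁻¹).toReal ENNReal.toReal_nonneg
  rw [ENNReal.ofReal_toReal (by simpa using hq0), ← hq, ENNReal.inv_mul_cancel hq0 hqt] at h1
  have h2 : ∫⁻ t in Set.Ioo (0:ℝ) 1, u t * (q⁻¹ * 1) ≤ 1 :=
    (le_iSup₂ (f := fun (φ : ℝ → ℝ≥0∞) (_ : Measurable φ ∧ ρ φ ≤ 1) =>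
      ∫⁻ t in Set.Ioo (0:ℝ) 1, u t * φ t) (fun _ => q⁻¹ * 1) ⟨measurable_const, h1.le⟩).trans hu
  rw [lintegral_mul_const' _ _ (by simpa using hq0), mul_one, ← div_eq_mul_inv] at h2
  rw [ENNReal.div_le_iff hq0 hqt] at h2
  simpa using h2

lemma le_opt (I : ℝ → ℝ) (ρ : (ℝ → ℝ≥0∞) → ℝ≥0∞) (f g : ℝ → ℝ≥0∞) (hg : Measurable g)
    (h : assoc ρ (RI I (rearr g)) ≤ 1) :
    ∫⁻ t in Set.Ioo (0:ℝ) 1, rearr f t * rearr g t ≤ optTargetNorm I ρ f :=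
  le_iSup₂ (f := fun (g : ℝ → ℝ≥0∞) (_ : Measurable g ∧ assoc ρ (RI I (rearr g)) ≤ 1) =>
    ∫⁻ t in Set.Ioo (0:ℝ) 1, rearr f t * rearr g t) g ⟨hg, h⟩

lemma rearr_const (a : ℝ≥0∞) (t : ℝ) (ht : t < 1) : a ≤ rearr (fun _ => a) t := by
  by_contra! h
  obtain ⟨l, hl1, hl2⟩ := exists_between h
  have h1 : ENNReal.ofReal t < volume {s ∈ Set.Ioo (0:ℝ) 1 | l < (fun _ => a) s} := by
    have : {s ∈ Set.Ioo (0:ℝ) 1 | l < (fun _ : ℝ => a) s} = Set.Ioo (0:ℝ) 1 := by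
      ext s; simp [hl2]
    rw [this, Real.volume_Ioo]
    simpa using ht
  exact absurd ((lt_rearr_iff (fun _ => a) l t).mpr h1) (not_lt.mpr hl1.le)

lemma lOne_le_opt {I : ℝ → ℝ} (hqc : Quasiconcave I) (ρ : (ℝ → ℝ≥0∞) → ℝ≥0∞) (c : ℝ) (hc : 0 < c)
    (hρ : ∀ f : ℝ → ℝ≥0∞, Measurable f →
      ∫⁻ t in Set.Ioo (0:ℝ) 1, f t ≤ ENNReal.ofReal c * ρ f)
    (f : ℝ → ℝ≥0∞) (hf : Measurable f) : lOne f ≤ ENNReal.ofReal c * optTargetNorm I ρ f := by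
  set C := ENNReal.ofReal c with hC
  have hC0 : C ≠ 0 := by simpa [hC] using hc
  have hCt : C ≠ ⊤ := ENNReal.ofReal_ne_top
  have hadm : assoc ρ (RI I (rearr fun _ => C⁻¹)) ≤ 1 := by
    have h1 : assoc ρ (RI I (rearr fun _ => C⁻¹)) ≤ assoc ρ (fun _ => C⁻¹) := by
      apply assoc_mono
      intro t ht
      have hI0 : ENNReal.ofReal (I t) ≠ 0 := by simpa using I_pos hqc ht
      calc RI I (rearr fun _ => C⁻¹) t
          ≤ (ENNReal.ofReal (I t))⁻¹ * ∫⁻ s in Set.Ioo (0:ℝ) t, C⁻¹ := by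
            refine mul_le_mul' le_rfl (lintegral_mono fun s => ?_)
            exact anti_rearr_le (fun _ => C⁻¹) antitone_const s
        _ = (ENNReal.ofReal (I t))⁻¹ * (C⁻¹ * ENNReal.ofReal t) := by
            rw [setLIntegral_const, Real.volume_Ioo, sub_zero]
        _ ≤ (ENNReal.ofReal (I t))⁻¹ * (C⁻¹ * ENNReal.ofReal (I t)) := by
            refine mul_le_mul' le_rfl (mul_le_mul' le_rfl (ENNReal.ofReal_le_ofReal (I_ge hqc ht)))
        _ = C⁻¹ := by
            rw [mul_left_comm, ENNReal.inv_mul_cancel hI0 ENNReal.ofReal_ne_top, mul_one]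
    refine h1.trans (iSup₂_le ?_)
    rintro φ ⟨hφ, hφ1⟩
    rw [lintegral_const_mul _ hφ]
    calc C⁻¹ * ∫⁻ t in Set.Ioo (0:ℝ) 1, φ t ≤ C⁻¹ * (C * 1) :=
          mul_le_mul' le_rfl ((hρ φ hφ).trans (mul_le_mul' le_rfl hφ1))
      _ = 1 := by rw [mul_one, ENNReal.inv_mul_cancel hC0 hCt]
  have h2 := le_opt I ρ f (fun _ => C⁻¹) measurable_const hadm
  have h3 : C⁻¹ * lOne f ≤ optTargetNorm I ρ f := by
    refine le_trans ?_ h2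
    rw [lOne, ← rearr_int f hf, ← lintegral_const_mul _ (rearr_anti f).measurable]
    refine setLIntegral_mono' measurableSet_Ioo fun t ht => ?_
    rw [mul_comm]
    exact mul_le_mul' le_rfl (rearr_const _ t ht.2)
  calc lOne f = C * (C⁻¹ * lOne f) := by
        rw [← mul_assoc, ENNReal.mul_inv_cancel hC0 hCt, one_mul]
    _ ≤ _ := mul_le_mul' le_rfl h3

lemma rearr_fin (f : ℝ → ℝ≥0∞) (hf : Measurable f) (h : lOne f ≠ ⊤) (t : ℝ) (ht : 0 < t) :
    rearr f t ≠ ⊤ := by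
  intro hc
  apply h
  rw [lOne, ← rearr_int f hf, eq_top_iff]
  have hm : 0 < min t 1 := lt_min ht one_pos
  calc ⊤ = ∫⁻ s in Set.Ioo (0:ℝ) (min t 1), ⊤ := by
        rw [setLIntegral_const, Real.volume_Ioo, sub_zero, ENNReal.top_mul]
        simpa using ht
    _ ≤ ∫⁻ s in Set.Ioo (0:ℝ) (min t 1), rearr f s := by
        refine setLIntegral_mono' measurableSet_Ioo fun s hs => ?_
        rw [← hc]
        exact rearr_anti f (hs.2.le.trans (min_le_left _ _))
    _ ≤ _ := lintegral_mono_set (Set.Ioo_subset_Ioo_right (min_le_right _ _))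

lemma L_le (F : ℝ → ℝ≥0∞) (hF : Antitone F) :
    (⨅ n : ℕ, F (1 - 1 / ((n:ℝ) + 2))) ≤ ∫⁻ t in Set.Ioo (0:ℝ) 1, F t := by
  set L := ⨅ n : ℕ, F (1 - 1 / ((n:ℝ) + 2)) with hL
  calc L = ∫⁻ t in Set.Ioo (0:ℝ) 1, L := by simp [setLIntegral_const]
    _ ≤ _ := by
      refine setLIntegral_mono' measurableSet_Ioo fun t ht => ?_
      obtain ⟨n, hn⟩ := exists_nat_one_div_lt (sub_pos.mpr ht.2)
      refine (iInf_le _ n).trans (hF ?_)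
      have : 1 / ((n:ℝ) + 2) ≤ 1 / ((n:ℝ) + 1) := by
        apply one_div_le_one_div_of_le <;> [positivity; linarith]
      linarith

lemma int_rearr_le {I : ℝ → ℝ} (hqc : Quasiconcave I) (ρ : (ℝ → ℝ≥0∞) → ℝ≥0∞) (hρ : IsRiNorm ρ)
    (γ : ℝ → ℝ≥0∞) (hγ : Antitone γ) (hg : assoc ρ (RI I γ) ≤ 1) :
    ∫⁻ t in Set.Ioo (0:ℝ) 1, γ t ≤ 4 * ρ (fun _ => 1) := by
  set G := ∫⁻ t in Set.Ioo (0:ℝ) 1, γ t with hG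
  have h2 : ∀ t ∈ Set.Ioo (1/2:ℝ) 1, G ≤ 2 * RI I γ t := by
    intro t ht
    have ht' : t ∈ Set.Ioo (0:ℝ) 1 := ⟨by linarith [ht.1], ht.2⟩
    refine (G_double γ hγ t 1 (by linarith [ht.1])).trans (mul_le_mul' le_rfl ?_)
    rw [RI]
    have : 1 ≤ (ENNReal.ofReal (I t))⁻¹ := by
      rw [ENNReal.one_le_inv]
      exact ENNReal.ofReal_le_one.mpr (I_lt_one hqc ht').le
    exact le_mul_of_one_le_left (zero_le) this
  have h3 : G * ENNReal.ofReal (1/2) ≤ 2 * ρ (fun _ => 1) := by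
    calc G * ENNReal.ofReal (1/2) = ∫⁻ t in Set.Ioo (1/2:ℝ) 1, G := by
          rw [setLIntegral_const, Real.volume_Ioo]; norm_num
      _ ≤ ∫⁻ t in Set.Ioo (1/2:ℝ) 1, 2 * RI I γ t := setLIntegral_mono' measurableSet_Ioo h2
      _ ≤ ∫⁻ t in Set.Ioo (0:ℝ) 1, 2 * RI I γ t :=
          lintegral_mono_set (Set.Ioo_subset_Ioo_left (by norm_num))
      _ = 2 * ∫⁻ t in Set.Ioo (0:ℝ) 1, RI I γ t := lintegral_const_mul' _ _ ENNReal.ofNat_ne_top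
      _ ≤ _ := mul_le_mul' le_rfl (int_le_rho ρ hρ _ hg)
  calc G = 2 * (G * ENNReal.ofReal (1/2)) := by
        have : (2:ℝ≥0∞) * ENNReal.ofReal (1/2) = 1 := by
          rw [show (2:ℝ≥0∞) = ENNReal.ofReal 2 by simp, ← ENNReal.ofReal_mul zero_le_two]
          norm_num
        rw [mul_left_comm, this, mul_one]
    _ ≤ 2 * (2 * ρ (fun _ => 1)) := mul_le_mul' le_rfl h3
    _ = _ := by ring

lemma upper_one {I : ℝ → ℝ} (hqc : Quasiconcave I) (ρ : (ℝ → ℝ≥0∞) → ℝ≥0∞) (hρ : IsRiNorm ρ)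
    (f : ℝ → ℝ≥0∞) (ν : Measure ℝ) (hfin : ∀ t, 0 < t → rearr f t ≠ ⊤)
    (hν : ∀ a b : ℝ, 0 < a → a ≤ b → b < 1 → ν (Set.Ioc a b) = rearr f a - rearr f b)
    (g : ℝ → ℝ≥0∞) (hg : assoc ρ (SI I g) ≤ 1) :
    ∫⁻ t in Set.Ioo (0:ℝ) 1, ENNReal.ofReal (I t) * rearr g t ∂ν ≤ 4 * optTargetNorm I ρ f := by
  set K : ℝ → ℝ≥0∞ := fun t => ⨆ s ∈ Set.Ioc (0:ℝ) t, ENNReal.ofReal (I s) * rearr g s with hKdef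
  have hK : Monotone K := fun a b hab => biSup_mono fun s hs => ⟨hs.1, hs.2.trans hab⟩
  have hK0 : ∀ t ≤ 0, K t = 0 := by
    intro t ht
    simp only [hKdef, ENNReal.iSup_eq_zero]
    intro s hs
    exact absurd (hs.1.trans_le hs.2) (not_lt.mpr ht)
  have hSI : ∀ t, SI I g t = (ENNReal.ofReal (I t))⁻¹ * K t := fun t => rfl
  have hKfin : ∀ t ∈ Set.Ioo (0:ℝ) 1, K t ≠ ⊤ := by
    intro t ht htop
    have h1 := int_le_rho ρ hρ _ hg
    have h2 : ∫⁻ s in Set.Ioo (0:ℝ) 1, SI I g s = ⊤ := by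
      rw [eq_top_iff]
      calc ⊤ = ∫⁻ s in Set.Ioo t 1, ⊤ := by
            rw [setLIntegral_const, Real.volume_Ioo, ENNReal.top_mul]
            simpa using ht.2
        _ ≤ ∫⁻ s in Set.Ioo t 1, SI I g s := by
            refine setLIntegral_mono' measurableSet_Ioo fun s hs => ?_
            have : K s = ⊤ := top_le_iff.mp (htop ▸ hK hs.1.le)
            rw [hSI, this, ENNReal.mul_top]
            simp
        _ ≤ _ := lintegral_mono_set (Set.Ioo_subset_Ioo_left ht.1.le)
    rw [h2] at h1
    exact absurd (top_le_iff.mp h1) hρ.2.2.2.2.2.1.ne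
  have hq : ∀ r ∈ Set.Ioo (0:ℝ) 1, ∀ s ∈ Set.Ioo (0:ℝ) 1, r ≤ s →
      K s * ENNReal.ofReal r ≤ K r * ENNReal.ofReal s := by
    intro r hr s hs hrs
    simp only [hKdef]
    rw [ENNReal.iSup_mul]
    simp_rw [ENNReal.iSup_mul]
    refine iSup₂_le fun q hq => ?_
    rcases le_or_gt q r with h | h
    · refine le_trans (mul_le_mul' ?_ (ENNReal.ofReal_le_ofReal hrs))
        (le_iSup₂ (f := fun i (_ : i ∈ Set.Ioc (0:ℝ) r) => ENNReal.ofReal (I i) * rearr g i *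
          ENNReal.ofReal s) q ⟨hq.1, h⟩)
      exact le_rfl
    · refine le_trans ?_ (le_iSup₂ (f := fun i (_ : i ∈ Set.Ioc (0:ℝ) r) =>
        ENNReal.ofReal (I i) * rearr g i * ENNReal.ofReal s) r ⟨hr.1, le_rfl⟩)
      have hq1 : q ∈ Set.Ioo (0:ℝ) 1 := ⟨hq.1, hq.2.trans_lt hs.2⟩
      have h1 : I q * r ≤ I r * s := (I_quasi hqc hr hq1 h.le).trans
        (mul_le_mul_of_nonneg_left hq.2 (I_pos hqc hr).le)
      have h2 : ENNReal.ofReal (I q) * ENNReal.ofReal r ≤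
          ENNReal.ofReal (I r) * ENNReal.ofReal s := by
        rw [← ENNReal.ofReal_mul (I_pos hqc hq1).le, ← ENNReal.ofReal_mul (I_pos hqc hr).le]
        exact ENNReal.ofReal_le_ofReal h1
      rw [mul_right_comm, mul_right_comm (ENNReal.ofReal (I r))]
      exact mul_le_mul' h2 (rearr_anti g h.le)
  have hn : ∀ n : ℕ, ∫⁻ t in Set.Ico (2 * (1 / ((n:ℝ) + 1))) 1, K t ∂ν ≤
      4 * optTargetNorm I ρ f := by
    intro n
    have hδ : 0 < 1 / ((n:ℝ) + 1) := by positivity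
    obtain ⟨k, hkm, hk1, hk2⟩ := exists_k K hK hK0 hKfin hq _ hδ
    have hadm : assoc ρ (RI I (rearr k)) ≤ 1 := by
      refine (assoc_mono ρ _ _ fun t ht => ?_).trans hg
      rw [hSI]
      exact mul_le_mul' le_rfl (hk1 t ht)
    have h1 := le_opt I ρ f k hkm hadm
    rw [nu_parts (rearr f) (rearr_anti f) hfin ν hν (rearr k) (rearr_anti k).measurable] at h1
    have hsub : Set.Ico (2 * (1 / ((n:ℝ) + 1))) 1 ⊆ Set.Ioo (0:ℝ) 1 :=
      fun s hs => ⟨lt_of_lt_of_le (by positivity) hs.1, hs.2⟩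
    calc ∫⁻ t in Set.Ico (2 * (1 / ((n:ℝ) + 1))) 1, K t ∂ν
        ≤ ∫⁻ t in Set.Ico (2 * (1 / ((n:ℝ) + 1))) 1, 4 * (∫⁻ s in Set.Ioo (0:ℝ) t, rearr k s) ∂ν :=
          setLIntegral_mono' measurableSet_Ico fun t ht => hk2 t (hsub ht) ht.1
      _ ≤ ∫⁻ t in Set.Ioo (0:ℝ) 1, 4 * (∫⁻ s in Set.Ioo (0:ℝ) t, rearr k s) ∂ν :=
          lintegral_mono_set hsub
      _ = 4 * ∫⁻ t in Set.Ioo (0:ℝ) 1, (∫⁻ s in Set.Ioo (0:ℝ) t, rearr k s) ∂ν :=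
          lintegral_const_mul' _ _ ENNReal.ofNat_ne_top
      _ ≤ _ := mul_le_mul' le_rfl (le_self_add.trans h1)
  have hU : Set.Ioo (0:ℝ) 1 = ⋃ n : ℕ, Set.Ico (2 * (1 / ((n:ℝ) + 1))) 1 := by
    ext t
    simp only [mem_Ioo, mem_iUnion, mem_Ico]
    constructor
    · rintro ⟨h1, h2⟩
      obtain ⟨n, hn⟩ := exists_nat_one_div_lt (half_pos h1)
      exact ⟨n, by linarith, h2⟩
    · rintro ⟨n, h1, h2⟩
      exact ⟨lt_of_lt_of_le (by positivity) h1, h2⟩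
  have hmon : Monotone fun n : ℕ => Set.Ico (2 * (1 / ((n:ℝ) + 1))) 1 := by
    intro m n hmn
    apply Set.Ico_subset_Ico_left
    have : (m:ℝ) ≤ n := by exact_mod_cast hmn
    gcongr
  calc ∫⁻ t in Set.Ioo (0:ℝ) 1, ENNReal.ofReal (I t) * rearr g t ∂ν
      ≤ ∫⁻ t in Set.Ioo (0:ℝ) 1, K t ∂ν :=
        setLIntegral_mono' measurableSet_Ioo fun t ht =>
          le_iSup₂ (f := fun s (_ : s ∈ Set.Ioc (0:ℝ) t) => ENNReal.ofReal (I s) * rearr g s)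
            t ⟨ht.1, le_rfl⟩
    _ = ⨆ n : ℕ, ∫⁻ t in Set.Ico (2 * (1 / ((n:ℝ) + 1))) 1, K t ∂ν := by
        rw [hU]
        exact setLIntegral_iUnion_of_directed _ hmon.directed_le
    _ ≤ _ := iSup_le hn

/-- Theorem 1.1 / `thm:Norm1`.  For quasiconcave `I` satisfying (★) and an
r.i. norm `‖·‖_X`, the optimal target norm satisfies
`‖f‖_{Y_X} ≈ sup_{‖S_I g‖_{X'} ≤ 1} ∫_0^1 -I(t) g^*(t) df^*(t) + ‖f‖_1`,
where the integral is taken against the Lebesgue–Stieltjes measure `ν` of the nonincreasing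
function `f^*`, i.e. any measure with `ν((a,b]) = f^*(a+) - f^*(b+)` for `0 < a ≤ b < 1`. -/
theorem statement0 (I : ℝ → ℝ) (hqc : Quasiconcave I) (hstar : StarCond I)
    (ρ : (ℝ → ℝ≥0∞) → ℝ≥0∞) (hρ : IsRiNorm ρ) :
    ∃ c₁ c₂ : ℝ, 0 < c₁ ∧ 0 < c₂ ∧
      ∀ f : ℝ → ℝ≥0∞, Measurable f →
        ∀ ν : Measure ℝ,
          (∀ a b : ℝ, 0 < a → a ≤ b → b < 1 →
            ν (Set.Ioc a b) =
              Function.rightLim (rearr f) a - Function.rightLim (rearr f) b) →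
          ENNReal.ofReal c₁ * optTargetNorm I ρ f ≤
              (⨆ (g : ℝ → ℝ≥0∞) (_ : Measurable g ∧ assoc ρ (SI I g) ≤ 1),
                ∫⁻ t in Set.Ioo (0:ℝ) 1, ENNReal.ofReal (I t) * rearr g t ∂ν) + lOne f ∧
            (⨆ (g : ℝ → ℝ≥0∞) (_ : Measurable g ∧ assoc ρ (SI I g) ≤ 1),
                ∫⁻ t in Set.Ioo (0:ℝ) 1, ENNReal.ofReal (I t) * rearr g t ∂ν) + lOne f ≤
              ENNReal.ofReal c₂ * optTargetNorm I ρ f := by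
  have hρ' := hρ
  obtain ⟨-, -, -, -, -, hone, ⟨c, hc, hcρ⟩, -⟩ := hρ'
  set M : ℝ := 16 + 4 * (ρ (fun _ => 1)).toReal with hM
  have hM0 : 0 < M := by positivity
  have hMe : ENNReal.ofReal M = 16 + 4 * ρ (fun _ => 1) := by
    rw [hM, ENNReal.ofReal_add (by norm_num) (by positivity), ENNReal.ofReal_mul (by norm_num),
      ENNReal.ofReal_toReal hone.ne]
    simp
  refine ⟨M⁻¹, 4 + c, inv_pos.mpr hM0, by positivity, ?_⟩
  intro f hf ν hν
  simp_rw [rearr_rightLim] at hν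
  have hl := lOne_le_opt hqc ρ c hc hcρ f hf
  by_cases htop : lOne f = ⊤
  · rw [htop] at hl ⊢
    have ho : optTargetNorm I ρ f = ⊤ := by
      by_contra h
      exact ENNReal.mul_ne_top ENNReal.ofReal_ne_top h (top_le_iff.mp hl)
    refine ⟨by simp, ?_⟩
    rw [ho, ENNReal.mul_top]
    · exact le_top
    · simp only [ne_eq, ENNReal.ofReal_eq_zero, not_le]
      positivity
  have hfin := rearr_fin f hf htop
  set S := (⨆ (g : ℝ → ℝ≥0∞) (_ : Measurable g ∧ assoc ρ (SI I g) ≤ 1),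
                ∫⁻ t in Set.Ioo (0:ℝ) 1, ENNReal.ofReal (I t) * rearr g t ∂ν) with hS
  constructor
  · have key : optTargetNorm I ρ f ≤ ENNReal.ofReal M * (S + lOne f) := by
      refine iSup₂_le ?_
      rintro g ⟨hg, hg1⟩
      rw [nu_parts (rearr f) (rearr_anti f) hfin ν hν (rearr g) (rearr_anti g).measurable]
      obtain ⟨h, hh, hle⟩ := exists_h hqc ρ hρ (rearr g) (rearr_anti g) hg1
      have h1 : ∫⁻ s in Set.Ioo (0:ℝ) 1, (∫⁻ t in Set.Ioo (0:ℝ) s, rearr g t) ∂ν ≤ 16 * S := by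
        calc ∫⁻ s in Set.Ioo (0:ℝ) 1, (∫⁻ t in Set.Ioo (0:ℝ) s, rearr g t) ∂ν
            ≤ ∫⁻ s in Set.Ioo (0:ℝ) 1, 16 * (ENNReal.ofReal (I s) * rearr h s) ∂ν :=
              setLIntegral_mono' measurableSet_Ioo hle
          _ = 16 * ∫⁻ s in Set.Ioo (0:ℝ) 1, ENNReal.ofReal (I s) * rearr h s ∂ν :=
              lintegral_const_mul' _ _ ENNReal.ofNat_ne_top
          _ ≤ 16 * S := by
              refine mul_le_mul' le_rfl ?_
              exact le_iSup₂ (f := fun (g : ℝ → ℝ≥0∞)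
                (_ : Measurable g ∧ assoc ρ (SI I g) ≤ 1) =>
                ∫⁻ t in Set.Ioo (0:ℝ) 1, ENNReal.ofReal (I t) * rearr g t ∂ν) h hh
      have h2 := L_le (rearr f) (rearr_anti f)
      rw [rearr_int f hf] at h2
      have h3 := int_rearr_le hqc ρ hρ (rearr g) (rearr_anti g) hg1
      refine (add_le_add h1 (mul_le_mul' h2 h3)).trans ?_
      rw [hMe, mul_add, mul_comm (∫⁻ t in Set.Ioo (0:ℝ) 1, f t)]
      exact add_le_add (mul_le_mul' le_self_add le_rfl) (mul_le_mul' le_add_self le_rfl)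
    calc ENNReal.ofReal M⁻¹ * optTargetNorm I ρ f
        ≤ ENNReal.ofReal M⁻¹ * (ENNReal.ofReal M * (S + lOne f)) := mul_le_mul' le_rfl key
      _ = S + lOne f := by
          rw [← mul_assoc, ← ENNReal.ofReal_mul (inv_pos.mpr hM0).le, inv_mul_cancel₀ hM0.ne']
          simp
  · rw [ENNReal.ofReal_add (by norm_num) hc.le, add_mul]
    refine add_le_add (iSup₂_le ?_) hl
    rintro g ⟨hg, hg1⟩
    simpa using upper_one hqc ρ hρ f ν hfin hν g hg1
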